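/- Moment bound for nearest-neighbor pairs: for every β > 0, ε > 0, L ≥ 2, every real m with 0 ≤ m ≤ β/2, and every collection of n pairwise distinct nearest-neighbor pairs (x₁,y₁), …, (xₙ,yₙ), one has ⟨∏_{j=1}^n B_{x_j y_j}^m⟩ₜₛ ≤ (1 − m/β)^{-n} ≤ 2^n. -/

import Mathlib

open scoped BigOperators Classical
open MeasureTheory

noncomputable section

/-- The 3-dimensional discrete torus of side `L`. -/
abbrev Torus (L : ℕ) := Fin 3 → ZMod L

/-- The unit vector in direction `i`. -/
def unitVec (L : ℕ) (i : Fin 3) : Torus L := fun j => if j = i then 1 else 0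

/-- Nearest-neighbor relation on the torus. -/
def NN {L : ℕ} (x y : Torus L) : Prop :=
  x ≠ y ∧ ∃ i : Fin 3, y = x + unitVec L i ∨ y = x - unitVec L i

/-- Periodic (Euclidean) distance on the torus. -/
def torusDist {L : ℕ} (x y : Torus L) : ℝ :=
  Real.sqrt (∑ i : Fin 3, (min ((x i - y i).val) (L - (x i - y i).val) : ℝ) ^ 2)

variable {L : ℕ}

/-- Sum of a (symmetric) function over unordered nearest-neighbor pairs. -/
def nnSum [NeZero L] (f : Torus L → Torus L → ℝ) : ℝ :=
  (1 / 2) * ∑ x : Torus L, ∑ y : Torus L, if NN x y then f x y else 0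

/-- The matrix of the operator `D_{β,ε}(t)`, the symmetric operator on `ℝ^Λ` with
quadratic form `β ∑_{NN (ij)} e^{t_i+t_j}(v_i-v_j)² + ε ∑_k e^{t_k} v_k²`. -/
def Dmat [NeZero L] (β ε : ℝ) (t : Torus L → ℝ) : Matrix (Torus L) (Torus L) ℝ :=
  Matrix.of fun j k =>
    if j = k then
      β * (∑ i : Torus L, if NN i j then Real.exp (t i + t j) else 0) + ε * Real.exp (t j)
    else if NN j k then -(β * Real.exp (t j + t k)) else 0

/-- The free energy (effective action) `F_{β,ε}(t)`. -/
def freeEnergy [NeZero L] (β ε : ℝ) (t : Torus L → ℝ) : ℝ :=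
  β * nnSum (fun i j => Real.cosh (t i - t j) - 1)
    - (1 / 2) * Real.log (Dmat β ε t).det
    + ∑ k : Torus L, (t k - ε + ε * Real.cosh (t k))

/-- The expectation `⟨f⟩ = ∫ f(t) e^{-F_{β,ε}(t)} ∏ dt_k/√(2π)`. -/
def expect [NeZero L] (β ε : ℝ) (f : (Torus L → ℝ) → ℝ) : ℝ :=
  ∫ t : Torus L → ℝ,
    f t * Real.exp (-(freeEnergy β ε t)) *
      ((Real.sqrt (2 * Real.pi))⁻¹) ^ (Fintype.card (Torus L))

/-- `B_{xy} = cosh(t_x - t_y) + (1/2)(s_x - s_y)² e^{t_x+t_y}`. -/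
def Bq {L : ℕ} (t s : Torus L → ℝ) (x y : Torus L) : ℝ :=
  Real.cosh (t x - t y) + (1 / 2) * (s x - s y) ^ 2 * Real.exp (t x + t y)

/-- `z^b_k = cosh t_k + (1/2) s_k² e^{t_k}`. -/
def zb {L : ℕ} (t s : Torus L → ℝ) (k : Torus L) : ℝ :=
  Real.cosh (t k) + (1 / 2) * (s k) ^ 2 * Real.exp (t k)

/-- The `(t,s)`-expectation of the `H^{2|2}` model after integrating out the
Grassmann fields. -/
def tsExpect [NeZero L] (β ε : ℝ) (g : (Torus L → ℝ) → (Torus L → ℝ) → ℝ) : ℝ :=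
  ∫ p : (Torus L → ℝ) × (Torus L → ℝ),
    g p.1 p.2 * (Dmat β ε p.1).det *
      Real.exp (-(β * nnSum (fun i j => Bq p.1 p.2 i j - 1))
        - ε * ∑ k : Torus L, (zb p.1 p.2 k - 1)) *
      (∏ k : Torus L, Real.exp (-(p.1 k))) * ((2 * Real.pi)⁻¹) ^ (Fintype.card (Torus L))

/-- The coordinate unit vector `δ_x`. -/
def delta {L : ℕ} (x : Torus L) : Torus L → ℝ := fun j => if j = x then 1 else 0

/-- `[u ; G v] = ∑_{a,b} u_a G_{ab} v_b`. -/
def qform [NeZero L] (G : Matrix (Torus L) (Torus L) ℝ) (u v : Torus L → ℝ) : ℝ :=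
  ∑ a : Torus L, ∑ b : Torus L, u a * G a b * v b

lemma aux_gauss_lint : ∫⁻ x : ℝ, ENNReal.ofReal (Real.exp (-(1/2) * x ^ 2))
    = ENNReal.ofReal (Real.sqrt (2 * Real.pi)) := by
  rw [← ofReal_integral_eq_lintegral_ofReal]
  · rw [integral_gaussian]; congr 2; ring
  · exact integrable_exp_neg_mul_sq (by norm_num)
  · exact Filter.Eventually.of_forall fun x => (Real.exp_pos _).le

open scoped MatrixOrder in
lemma aux_gauss_matrix {V : Type*} [Fintype V] [DecidableEq V] (D : Matrix V V ℝ)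
    (hD : D.PosDef) :
    ∫⁻ s : V → ℝ, ENNReal.ofReal (Real.exp (-(1/2) * (s ⬝ᵥ D.mulVec s)))
      = ENNReal.ofReal (Real.sqrt (2 * Real.pi) ^ Fintype.card V / Real.sqrt D.det) := by
  obtain ⟨B, hB⟩ : ∃ B : Matrix V V ℝ, D = B.transpose * B := by
    obtain ⟨B, hB⟩ := CStarAlgebra.nonneg_iff_eq_star_mul_self.mp hD.posSemidef.nonneg
    exact ⟨B, by simpa [Matrix.star_eq_conjTranspose] using hB⟩
  have hdet : D.det = B.det ^ 2 := by rw [hB, Matrix.det_mul, Matrix.det_transpose]; ring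
  have hpos := hD.det_pos
  have hB0 : B.det ≠ 0 := by
    intro h; rw [hdet, h] at hpos; simp at hpos
  have hq : ∀ s : V → ℝ, s ⬝ᵥ D.mulVec s = ∑ i, (B.mulVec s i) ^ 2 := by
    intro s
    rw [hB, ← Matrix.mulVec_mulVec, Matrix.dotProduct_mulVec, Matrix.vecMul_transpose]
    simp [dotProduct, sq]
  have h1 : ∫⁻ u : V → ℝ, ENNReal.ofReal (Real.exp (-(1/2) * ∑ i, (u i) ^ 2))
      = ENNReal.ofReal (Real.sqrt (2 * Real.pi) ^ Fintype.card V) := by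
    have hf : ∀ u : V → ℝ, Real.exp (-(1/2) * ∑ i, (u i) ^ 2)
        = ∏ i, Real.exp (-(1/2) * (u i) ^ 2) := by
      intro u; rw [Finset.mul_sum, Real.exp_sum]
    rw [← ofReal_integral_eq_lintegral_ofReal]
    · simp_rw [hf]
      rw [integral_fintype_prod_volume_eq_pow (fun x : ℝ => Real.exp (-(1/2) * x ^ 2)), integral_gaussian]
      congr 3; ring
    · simp_rw [hf]
      exact Integrable.fintype_prod (f := fun _ x => Real.exp (-(1/2) * x ^ 2)) fun i => integrable_exp_neg_mul_sq (by norm_num)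
    · exact Filter.Eventually.of_forall fun x => (Real.exp_pos _).le
  have hmap := Real.map_matrix_volume_pi_eq_smul_volume_pi hB0
  have hmeas : Measurable fun u : V → ℝ => ENNReal.ofReal (Real.exp (-(1/2) * ∑ i, (u i) ^ 2)) := by
    fun_prop
  have hmT : Measurable (Matrix.toLin' B) := by
    exact (LinearMap.continuous_of_finiteDimensional _).measurable
  have h2 := lintegral_map (μ := volume) hmeas hmT
  rw [hmap, lintegral_smul_measure, h1] at h2
  simp_rw [hq]
  simp only [Matrix.toLin'_apply] at h2
  rw [← h2, hdet, Real.sqrt_sq_eq_abs, smul_eq_mul, ← ENNReal.ofReal_mul (abs_nonneg _), abs_inv]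
  congr 1; field_simp

lemma aux_ig (a : ℝ) : ∫⁻ u in Set.Ioi (0:ℝ),
      ENNReal.ofReal (Real.exp (-(1/2) * u - (1/2) * (a ^ 2 / u)) / Real.sqrt u)
    ≤ ENNReal.ofReal (Real.sqrt (2 * Real.pi) * Real.exp (-a)) := by
  wlog ha : 0 ≤ a generalizing a
  · push Not at ha
    have := this (-a) (by linarith)
    rw [neg_sq] at this
    refine this.trans (ENNReal.ofReal_le_ofReal ?_)
    gcongr; linarith
  set φ : ℝ → ℝ := fun u => Real.exp (-(1/2) * u - (1/2) * (a ^ 2 / u)) with hφ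
  set I := ∫⁻ u in Set.Ioi (0:ℝ), ENNReal.ofReal (φ u / Real.sqrt u) with hI
  -- first: change of variable x = √u - a/√u
  have hder : ∀ u ∈ Set.Ioi (0:ℝ), HasDerivWithinAt (fun u : ℝ => Real.sqrt u - a / Real.sqrt u)
      ((1/2) * (1 / Real.sqrt u + a / (u * Real.sqrt u))) (Set.Ioi 0) u := by
    intro u hu
    have hu : 0 < u := hu
    have hs := Real.sqrt_pos.mpr hu
    have h1 := Real.hasDerivAt_sqrt hu.ne'
    have h2 := h1.sub ((hasDerivAt_const u a).div h1 hs.ne')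
    refine (h2.congr_deriv ?_).hasDerivWithinAt
    have := Real.sq_sqrt hu.le
    field_simp
    rw [this]; field_simp; ring
  have hinj : Set.InjOn (fun u : ℝ => Real.sqrt u - a / Real.sqrt u) (Set.Ioi 0) := by
    apply StrictMonoOn.injOn
    intro u hu v hv huv
    have hu : 0 < u := hu
    have hs := Real.sqrt_pos.mpr hu
    have h1 := Real.sqrt_lt_sqrt hu.le huv
    have : a / Real.sqrt v ≤ a / Real.sqrt u := by gcongr
    simp only; linarith
  have hcv := lintegral_image_eq_lintegral_abs_deriv_mul measurableSet_Ioi hder hinj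
    (fun x => ENNReal.ofReal (Real.exp (-(1/2) * x ^ 2)))
  have hle0 : ∫⁻ x in (fun u : ℝ => Real.sqrt u - a / Real.sqrt u) '' Set.Ioi 0,
      ENNReal.ofReal (Real.exp (-(1/2) * x ^ 2))
      ≤ ENNReal.ofReal (Real.sqrt (2 * Real.pi) * (if a = 0 then 1 / 2 else 1)) := by
    split_ifs with h0
    · have hsub : (fun u : ℝ => Real.sqrt u - a / Real.sqrt u) '' Set.Ioi 0 ⊆ Set.Ioi 0 := by
        rintro _ ⟨u, hu, rfl⟩
        have hu : 0 < u := hu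
        simpa [h0] using hu
      refine (lintegral_mono_set hsub).trans (le_of_eq ?_)
      rw [← ofReal_integral_eq_lintegral_ofReal]
      · rw [integral_gaussian_Ioi]; congr 1
        rw [show Real.pi / (1/2) = 2 * Real.pi by ring]; ring
      · exact (integrable_exp_neg_mul_sq (by norm_num)).integrableOn
      · exact Filter.Eventually.of_forall fun x => (Real.exp_pos _).le
    · rw [mul_one, ← aux_gauss_lint]
      exact setLIntegral_le_lintegral _ _
  have hle : ∫⁻ u in Set.Ioi (0:ℝ), ENNReal.ofReal ((1/2) * (1 / Real.sqrt u + a / (u * Real.sqrt u)) * (φ u * Real.exp a))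
      ≤ ENNReal.ofReal (Real.sqrt (2 * Real.pi) * (if a = 0 then 1 / 2 else 1)) := by
    refine le_trans (le_of_eq ?_) hle0
    rw [hcv]
    refine setLIntegral_congr_fun measurableSet_Ioi fun u hu => ?_
    have hu : 0 < u := hu
    have hs := Real.sqrt_pos.mpr hu
    rw [← ENNReal.ofReal_mul (abs_nonneg _), abs_of_nonneg (by positivity), hφ, ← Real.exp_add]
    congr 3
    have := Real.sq_sqrt hu.le
    rw [sub_sq, div_pow, this]
    field_simp
    ring
  -- symmetry
  have hsym : ∫⁻ u in Set.Ioi (0:ℝ), ENNReal.ofReal (a / (u * Real.sqrt u) * φ u) = if a = 0 then 0 else I := by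
    split_ifs with h0
    · simp [h0]
    have ha' : 0 < a := lt_of_le_of_ne ha (Ne.symm h0)
    have hd2 : ∀ u ∈ Set.Ioi (0:ℝ), HasDerivWithinAt (fun u : ℝ => a ^ 2 / u)
        (-(a ^ 2 / u ^ 2)) (Set.Ioi 0) u := by
      intro u hu
      have hu : 0 < u := hu
      have := ((hasDerivAt_const u (a^2)).div (hasDerivAt_id u) hu.ne')
      refine (this.congr_deriv ?_).hasDerivWithinAt
      simp; ring
    have hinj2 : Set.InjOn (fun u : ℝ => a ^ 2 / u) (Set.Ioi 0) := by
      intro u hu v hv h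
      have hu : 0 < u := hu
      have hv : 0 < v := hv
      simp only at h
      rw [div_eq_div_iff hu.ne' hv.ne'] at h
      exact (mul_left_cancel₀ (by positivity) h).symm
    have hcv2 := lintegral_image_eq_lintegral_abs_deriv_mul measurableSet_Ioi hd2 hinj2
      (fun u => ENNReal.ofReal (φ u / Real.sqrt u))
    have himg : (fun u : ℝ => a ^ 2 / u) '' Set.Ioi 0 = Set.Ioi 0 := by
      ext v; constructor
      · rintro ⟨u, hu, rfl⟩
        have hu : 0 < u := hu
        show 0 < a ^ 2 / u
        positivity
      · intro hv
        have hv : 0 < v := hv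
        refine ⟨a ^ 2 / v, ?_, ?_⟩
        · show 0 < a ^ 2 / v
          positivity
        · simp only; field_simp
    rw [himg] at hcv2
    rw [hI, hcv2]
    refine setLIntegral_congr_fun measurableSet_Ioi fun u hu => ?_
    have hu : 0 < u := hu
    have hs := Real.sqrt_pos.mpr hu
    rw [← ENNReal.ofReal_mul (abs_nonneg _), abs_neg, abs_of_nonneg (by positivity)]
    congr 1
    have e1 : φ (a ^ 2 / u) = φ u := by
      simp only [hφ]; congr 1; field_simp; ring
    rw [e1, Real.sqrt_div (sq_nonneg _), Real.sqrt_sq ha]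
    have := Real.sq_sqrt hu.le
    field_simp
    rw [this]
  have hsplit : ∫⁻ u in Set.Ioi (0:ℝ), ENNReal.ofReal ((1/2) * (1 / Real.sqrt u + a / (u * Real.sqrt u)) * (φ u * Real.exp a))
      = ENNReal.ofReal (1/2 * Real.exp a) * (I + if a = 0 then 0 else I) := by
    rw [← hsym, hI, ← lintegral_add_left (by fun_prop), ← lintegral_const_mul _ (by fun_prop)]
    refine setLIntegral_congr_fun measurableSet_Ioi fun u hu => ?_
    have hu : 0 < u := hu
    have hs := Real.sqrt_pos.mpr hu
    have hp : 0 < φ u := Real.exp_pos _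
    rw [← ENNReal.ofReal_add (by positivity) (by positivity), ← ENNReal.ofReal_mul (by positivity)]
    congr 1; ring
  rw [hsplit] at hle
  have hI2 : ENNReal.ofReal (Real.exp a) * I ≤ ENNReal.ofReal (Real.sqrt (2 * Real.pi)) := by
    split_ifs at hle with h0
    · rw [add_zero, ENNReal.ofReal_mul (by norm_num), mul_assoc, mul_comm (Real.sqrt _), ENNReal.ofReal_mul (by norm_num)] at hle
      exact (ENNReal.mul_le_mul_iff_right (by simp) (by simp)).mp hle
    · rw [← two_mul, mul_one, ← mul_assoc] at hle
      refine le_trans (le_of_eq ?_) hle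
      congr 1
      rw [show (2 : ENNReal) = ENNReal.ofReal 2 by simp, ← ENNReal.ofReal_mul (by positivity)]
      congr 1; ring
  calc I = ENNReal.ofReal (Real.exp (-a)) * (ENNReal.ofReal (Real.exp a) * I) := by
        rw [← mul_assoc, ← ENNReal.ofReal_mul (by positivity), ← Real.exp_add]; simp
    _ ≤ ENNReal.ofReal (Real.exp (-a)) * ENNReal.ofReal (Real.sqrt (2 * Real.pi)) := by gcongr
    _ = _ := by rw [← ENNReal.ofReal_mul (by positivity), mul_comm]

/-- The integrand in the `b`-variables. -/
def HPfun {V : Type*} [Fintype V] [DecidableEq V] (C : Matrix V V ℝ) (η b : V → ℝ) : ENNReal :=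
  if (Matrix.diagonal b - C).PosDef then
    ENNReal.ofReal (Real.exp (-(1/2) * ∑ i, b i - (1/2) * (η ⬝ᵥ (Matrix.diagonal b - C)⁻¹.mulVec η))
      / Real.sqrt (Matrix.diagonal b - C).det) else 0

def HP (V : Type*) [Fintype V] [DecidableEq V] : Prop :=
  ∀ (C : Matrix V V ℝ) (η : V → ℝ), C.IsSymm → ∫⁻ b, HPfun C η b ≤
    ENNReal.ofReal (Real.sqrt (2 * Real.pi) ^ Fintype.card V *
      Real.exp (-(1/2) * ∑ i, ∑ j, C i j - ∑ i, η i))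

lemma HP_equiv {V W : Type*} [Fintype V] [DecidableEq V] [Fintype W] [DecidableEq W]
    (e : V ≃ W) (h : HP V) : HP W := by
  intro C η hC
  have h1 := h (C.submatrix e e) (η ∘ e) (hC.submatrix e)
  have hmp := volume_measurePreserving_piCongrLeft (fun _ : W => ℝ) e
  rw [← hmp.lintegral_comp_emb (MeasurableEquiv.measurableEmbedding _)]
  have hF : ∀ b : V → ℝ, HPfun C η (MeasurableEquiv.piCongrLeft (fun _ : W => ℝ) e b)
      = HPfun (C.submatrix e e) (η ∘ e) b := by
    intro b
    obtain ⟨b', rfl⟩ : ∃ b' : W → ℝ, b = b' ∘ e := ⟨b ∘ e.symm, by ext; simp⟩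
    have hb : MeasurableEquiv.piCongrLeft (fun _ : W => ℝ) e (b' ∘ e) = b' := by
      ext w
      obtain ⟨v, rfl⟩ := e.surjective w
      exact Equiv.piCongrLeft_apply_apply (fun _ : W => ℝ) e (b' ∘ e) v
    rw [hb]
    have hM : Matrix.diagonal (b' ∘ e) - C.submatrix e e
        = (Matrix.diagonal b' - C).submatrix e e := by
      rw [← Matrix.submatrix_diagonal_equiv]; rfl
    have hP : ((Matrix.diagonal b' - C).submatrix e e).PosDef ↔ (Matrix.diagonal b' - C).PosDef := by
      constructor
      · intro h
        have := h.submatrix e.symm.injective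
        simpa using this
      · intro h
        exact h.submatrix e.injective
    unfold HPfun
    rw [hM]
    simp only [hP, Matrix.det_submatrix_equiv_self, Matrix.inv_submatrix_equiv]
    have hs : ∑ i, (b' ∘ e) i = ∑ i, b' i := e.sum_comp b'
    have hq : (η ∘ e) ⬝ᵥ ((Matrix.diagonal b' - C)⁻¹.submatrix e e).mulVec (η ∘ e)
      = η ⬝ᵥ (Matrix.diagonal b' - C)⁻¹.mulVec η := by
      rw [Matrix.submatrix_mulVec_equiv]
      simp only [dotProduct, Function.comp_assoc, Equiv.self_comp_symm, Function.comp_id]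
      exact e.sum_comp (fun i => η i * ((Matrix.diagonal b' - C)⁻¹.mulVec η) i)
    rw [hs, hq]
  simp_rw [hF]
  refine h1.trans (le_of_eq ?_)
  have e1 : ∑ i, ∑ j, (C.submatrix e e) i j = ∑ i, ∑ j, C i j := by
    rw [← e.sum_comp]
    refine Finset.sum_congr rfl fun i _ => ?_
    exact e.sum_comp (fun j => C (e i) j)
  have e2 : ∑ i, (η ∘ e) i = ∑ i, η i := e.sum_comp η
  rw [e1, e2, Fintype.card_congr e]

lemma HP_empty (V : Type*) [Fintype V] [DecidableEq V] [IsEmpty V] : HP V := by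
  intro C η hC
  have : ∀ b : V → ℝ, HPfun C η b ≤ 1 := by
    intro b
    unfold HPfun
    split_ifs <;> simp
  refine (lintegral_mono this).trans ?_
  simp [volume_pi]

lemma HP_schur {V : Type*} [Fintype V] [DecidableEq V] (H : Matrix V V ℝ) (c η' : V → ℝ)
    (d η0 : ℝ) (M : Matrix (V ⊕ Unit) (V ⊕ Unit) ℝ)
    (hMdef : M = Matrix.fromBlocks H (Matrix.of fun i _ => - c i) (Matrix.of fun _ i => - c i)
      (Matrix.of fun _ _ => d)) (hM : M.PosDef) :
    H.PosDef ∧ 0 < d - c ⬝ᵥ H⁻¹.mulVec c ∧ M.det = H.det * (d - c ⬝ᵥ H⁻¹.mulVec c) ∧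
    (Sum.elim η' (fun _ => η0)) ⬝ᵥ M⁻¹.mulVec (Sum.elim η' (fun _ => η0))
      = η' ⬝ᵥ H⁻¹.mulVec η' + (η0 + c ⬝ᵥ H⁻¹.mulVec η') ^ 2 / (d - c ⬝ᵥ H⁻¹.mulVec c) := by
  have hH : H.PosDef := by
    have := hM.submatrix (e := Sum.inl) Sum.inl_injective
    rw [hMdef] at this
    exact this
  have hHu : IsUnit H.det := hH.det_pos.ne'.isUnit
  have hMu : IsUnit M.det := hM.det_pos.ne'.isUnit
  have hsymm : ∀ v w : V → ℝ, v ⬝ᵥ H⁻¹.mulVec w = w ⬝ᵥ H⁻¹.mulVec v := by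
    intro v w
    have hs : H⁻¹.transpose = H⁻¹ := by
      have := hH.inv.isHermitian
      rwa [Matrix.IsHermitian, Matrix.conjTranspose_eq_transpose_of_trivial] at this
    rw [Matrix.dotProduct_mulVec, dotProduct_comm, ← Matrix.mulVec_transpose, hs]
  have hdet : M.det = H.det * (d - c ⬝ᵥ H⁻¹.mulVec c) := by
    let _ := Matrix.invertibleOfIsUnitDet H hHu
    rw [hMdef, Matrix.det_fromBlocks₁₁, Matrix.invOf_eq_nonsing_inv]
    congr 1
    rw [Matrix.det_unique]
    simp only [Matrix.sub_apply, Matrix.of_apply, Matrix.mul_apply, dotProduct, Matrix.mulVec]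
    simp only [Finset.sum_mul, Finset.mul_sum]
    rw [Finset.sum_comm]
    congr 1
    refine Finset.sum_congr rfl fun i _ => Finset.sum_congr rfl fun j _ => ?_
    ring
  have hu : 0 < d - c ⬝ᵥ H⁻¹.mulVec c := by
    have := hM.det_pos
    rw [hdet] at this
    exact (mul_pos_iff_of_pos_left hH.det_pos).mp this
  refine ⟨hH, hu, hdet, ?_⟩
  set u := d - c ⬝ᵥ H⁻¹.mulVec c with hudef
  set a := η0 + c ⬝ᵥ H⁻¹.mulVec η' with ha
  have hsolve : M.mulVec (Sum.elim (H⁻¹.mulVec (η' + (a / u) • c)) (fun _ => a / u))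
      = Sum.elim η' (fun _ => η0) := by
    rw [hMdef, Matrix.fromBlocks_mulVec]
    congr 1
    · simp only [Sum.elim_comp_inl, Sum.elim_comp_inr, Matrix.mulVec_mulVec, Matrix.mul_nonsing_inv _ hHu,
        Matrix.one_mulVec]
      ext i
      simp [Matrix.mulVec, dotProduct]
      ring
    · simp only [Sum.elim_comp_inl, Sum.elim_comp_inr]
      ext i
      have e1 : (Matrix.of fun (_ : Unit) i => - c i).mulVec (H⁻¹.mulVec (η' + (a / u) • c)) i
        = - (c ⬝ᵥ H⁻¹.mulVec (η' + (a / u) • c)) := by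
        simp [Matrix.mulVec, dotProduct]
      rw [Pi.add_apply, e1, Matrix.mulVec_add, dotProduct_add, Matrix.mulVec_smul, dotProduct_smul]
      have e2 : (Matrix.of fun (_ : Unit) (_ : Unit) => d).mulVec (fun _ => a / u) i = d * (a / u) := by
        simp [Matrix.mulVec, dotProduct]
      rw [e2, smul_eq_mul]
      have e3 : a / u * u = a := div_mul_cancel₀ _ hu.ne'
      linear_combination -(a / u) * hudef + e3 + ha
  have hinv : M⁻¹.mulVec (Sum.elim η' (fun _ => η0))
      = Sum.elim (H⁻¹.mulVec (η' + (a / u) • c)) (fun _ => a / u) := by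
    rw [← hsolve, Matrix.mulVec_mulVec, Matrix.nonsing_inv_mul _ hMu, Matrix.one_mulVec]
  rw [hinv, sumElim_dotProduct_sumElim, Matrix.mulVec_add, dotProduct_add, Matrix.mulVec_smul, dotProduct_smul,
    hsymm η' c]
  simp only [dotProduct, Finset.univ_unique, Finset.sum_singleton, smul_eq_mul] at ha ⊢
  rw [ha]; ring

lemma HP_step {V : Type*} [Fintype V] [DecidableEq V] (h : HP V) : HP (V ⊕ Unit) := by
  intro C η hC
  set c : V → ℝ := fun i => C (Sum.inl i) (Sum.inr ()) with hc
  set γ : ℝ := C (Sum.inr ()) (Sum.inr ()) with hγ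
  set C' : Matrix V V ℝ := C.submatrix Sum.inl Sum.inl with hC'
  set η' : V → ℝ := fun i => η (Sum.inl i) with hη'
  set η0 : ℝ := η (Sum.inr ()) with hη0
  have hη : η = Sum.elim η' (fun _ => η0) := by ext (i | i) <;> rfl
  have hIH := h C' (η' + c) (hC.submatrix _)
  have hmp := (volume_measurePreserving_sumPiEquivProdPi_symm (fun _ : V ⊕ Unit => ℝ))
  rw [← hmp.lintegral_comp_emb (MeasurableEquiv.measurableEmbedding _)]
  refine (lintegral_prod_le _).trans ?_
  have key : ∀ b' : V → ℝ, ∫⁻ b0 : Unit → ℝ,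
      HPfun C η ((MeasurableEquiv.sumPiEquivProdPi (fun _ : V ⊕ Unit => ℝ)).symm (b', b0))
      ≤ ENNReal.ofReal (Real.sqrt (2 * Real.pi) * Real.exp (-(1/2) * γ - η0)) * HPfun C' (η' + c) b' := by
    intro b'
    rw [← (volume_preserving_funUnique Unit ℝ).symm.lintegral_comp_emb (MeasurableEquiv.measurableEmbedding _)]
    set H := Matrix.diagonal b' - C' with hH
    set q := c ⬝ᵥ H⁻¹.mulVec c with hq
    set a := η0 + c ⬝ᵥ H⁻¹.mulVec η' with ha
    have hbeq : ∀ b0 : ℝ, ((MeasurableEquiv.sumPiEquivProdPi (fun _ : V ⊕ Unit => ℝ)).symm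
        (b', (MeasurableEquiv.funUnique Unit ℝ).symm b0)) = Sum.elim b' (fun _ => b0) := by
      intro b0; ext (i | i) <;> rfl
    have hMeq : ∀ b0 : ℝ, Matrix.diagonal (Sum.elim b' (fun _ : Unit => b0)) - C
        = Matrix.fromBlocks H (Matrix.of fun i _ => - c i) (Matrix.of fun _ i => - c i)
          (Matrix.of fun _ _ => b0 - γ) := by
      intro b0
      ext (i | i) (j | j)
      · simp [hH, hC', Matrix.diagonal_apply]
      · simp [hc]
      · simp [hc]
        exact hC.apply _ _
      · simp [hγ]
    by_cases hHP : H.PosDef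
    swap
    · have h0 : ∀ b0 : ℝ, HPfun C η ((MeasurableEquiv.sumPiEquivProdPi (fun _ : V ⊕ Unit => ℝ)).symm
        (b', (MeasurableEquiv.funUnique Unit ℝ).symm b0)) = 0 := by
        intro b0
        rw [hbeq, HPfun, if_neg]
        intro hM
        exact hHP (HP_schur H c η' (b0 - γ) η0 _ (hMeq b0) hM).1
      rw [lintegral_congr h0, lintegral_zero]
      exact zero_le
    have hpt : ∀ b0 : ℝ, HPfun C η ((MeasurableEquiv.sumPiEquivProdPi (fun _ : V ⊕ Unit => ℝ)).symm
        (b', (MeasurableEquiv.funUnique Unit ℝ).symm b0)) ≤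
        ENNReal.ofReal (Real.exp (-(1/2) * ∑ i, b' i - (1/2) * (γ + q) - (1/2) * (η' ⬝ᵥ H⁻¹.mulVec η'))
          / Real.sqrt H.det) *
        (Set.Ioi (0:ℝ)).indicator (fun u => ENNReal.ofReal (Real.exp (-(1/2) * u - (1/2) * (a ^ 2 / u)) / Real.sqrt u)) (b0 - (γ + q)) := by
      intro b0
      rw [hbeq, HPfun]
      split_ifs with hM
      swap
      · simp
      obtain ⟨-, hu, hdet, hquad⟩ := HP_schur H c η' (b0 - γ) η0 _ (hMeq b0) hM
      rw [hη, hquad, hdet]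
      have hueq : b0 - γ - c ⬝ᵥ H⁻¹.mulVec c = b0 - (γ + q) := by rw [hq]; ring
      rw [hueq] at hu ⊢
      rw [Set.indicator_of_mem (show b0 - (γ + q) ∈ Set.Ioi (0:ℝ) from hu),
        ← ENNReal.ofReal_mul (by positivity)]
      refine le_of_eq ?_
      congr 1
      rw [Real.sqrt_mul hHP.det_pos.le, div_mul_div_comm, ← Real.exp_add]
      congr 2
      simp only [Fintype.sum_sum_type, Sum.elim_inl, Sum.elim_inr, Finset.univ_unique, Finset.sum_singleton]
      rw [← ha]
      ring
    refine (lintegral_mono hpt).trans ?_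
    rw [lintegral_const_mul' _ _ ENNReal.ofReal_ne_top,
      lintegral_sub_right_eq_self (μ := volume) (fun v => (Set.Ioi (0:ℝ)).indicator (fun u => ENNReal.ofReal (Real.exp (-(1/2) * u - (1/2) * (a ^ 2 / u)) / Real.sqrt u)) v) (γ + q),
      lintegral_indicator measurableSet_Ioi]
    refine (mul_le_mul_right (aux_ig a) _).trans (le_of_eq ?_)
    rw [HPfun, if_pos hHP, ← ENNReal.ofReal_mul (by positivity), ← ENNReal.ofReal_mul (by positivity)]
    congr 1
    have hsymm : η' ⬝ᵥ H⁻¹.mulVec c = c ⬝ᵥ H⁻¹.mulVec η' := by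
      have hs : H⁻¹.transpose = H⁻¹ := by
        have := hHP.inv.isHermitian
        rwa [Matrix.IsHermitian, Matrix.conjTranspose_eq_transpose_of_trivial] at this
      rw [Matrix.dotProduct_mulVec, dotProduct_comm, ← Matrix.mulVec_transpose, hs]
    have hexp : (η' + c) ⬝ᵥ H⁻¹.mulVec (η' + c)
        = η' ⬝ᵥ H⁻¹.mulVec η' + 2 * (c ⬝ᵥ H⁻¹.mulVec η') + q := by
      rw [Matrix.mulVec_add, dotProduct_add, add_dotProduct, add_dotProduct, hsymm]; ring
    rw [hexp]
    rw [div_mul_eq_mul_div, mul_div_assoc', mul_left_comm, mul_assoc, ← Real.exp_add, ← Real.exp_add]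
    congr 3
    rw [ha]; ring
  refine (lintegral_mono key).trans ?_
  rw [lintegral_const_mul' _ _ ENNReal.ofReal_ne_top]
  refine (mul_le_mul_right hIH _).trans (le_of_eq ?_)
  rw [← ENNReal.ofReal_mul (by positivity)]
  congr 1
  rw [mul_mul_mul_comm, ← Real.exp_add, Fintype.card_sum, Fintype.card_unit, pow_succ']
  congr 2
  have e1 : ∑ i, ∑ j, C i j = ∑ i, ∑ j, C' i j + 2 * ∑ i, c i + γ := by
    simp only [Fintype.sum_sum_type, Finset.univ_unique, Finset.sum_singleton, Finset.sum_add_distrib]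
    have : ∀ j, C (Sum.inr default) (Sum.inl j) = c j := fun j => hC.apply _ _
    simp only [this]
    simp only [hC', hc, hγ, Matrix.submatrix_apply]
    ring
  have e2 : ∑ i, η i = ∑ i, η' i + η0 := by
    simp only [Fintype.sum_sum_type, Finset.univ_unique, Finset.sum_singleton]
    rfl
  rw [e1, e2]
  simp only [Pi.add_apply, Finset.sum_add_distrib]
  ring

lemma HP_fin (n : ℕ) : HP (Fin n) := by
  induction n with
  | zero => exact HP_empty _
  | succ n ih =>
    refine HP_equiv ?_ (HP_step ih)
    exact (Equiv.optionEquivSumPUnit (Fin n)).symm.trans (finSuccEquiv n).symm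

lemma HP_all (V : Type*) [Fintype V] [DecidableEq V] : HP V :=
  HP_equiv (Fintype.equivFin V).symm (HP_fin _)

section generic
variable {V : Type*} [Fintype V] [DecidableEq V]

/-- The map from the field `t` to the potential `b`. -/
def fb (C : Matrix V V ℝ) (η t : V → ℝ) : V → ℝ :=
  fun i => (∑ j, C i j * Real.exp (t j) + η i) * Real.exp (-(t i))

/-- The generalized weighted Laplacian. -/
def DC (C : Matrix V V ℝ) (η t : V → ℝ) : Matrix V V ℝ :=
  Matrix.of fun i j =>
    (if i = j then Real.exp (t i) * (∑ k, C i k * Real.exp (t k) + η i) else 0)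
      - Real.exp (t i) * C i j * Real.exp (t j)

lemma DC_eq (C : Matrix V V ℝ) (η t : V → ℝ) : DC C η t =
    Matrix.diagonal (fun i => Real.exp (t i)) * (Matrix.diagonal (fb C η t) - C)
      * Matrix.diagonal (fun i => Real.exp (t i)) := by
  ext i j
  rw [Matrix.mul_diagonal, Matrix.diagonal_mul, Matrix.sub_apply, Matrix.diagonal_apply, DC,
    Matrix.of_apply, fb]
  split_ifs with h
  · subst h
    have : Real.exp (-(t i)) * Real.exp (t i) = 1 := by rw [← Real.exp_add]; simp
    linear_combination -(Real.exp (t i)) * (∑ k, C i k * Real.exp (t k) + η i) * this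
  · ring

lemma H_eq (C : Matrix V V ℝ) (η t : V → ℝ) : Matrix.diagonal (fb C η t) - C =
    Matrix.diagonal (fun i => Real.exp (-(t i))) * DC C η t
      * Matrix.diagonal (fun i => Real.exp (-(t i))) := by
  have h1 : Matrix.diagonal (fun i => Real.exp (-(t i))) * Matrix.diagonal (fun i => Real.exp (t i)) = 1 := by
    rw [Matrix.diagonal_mul_diagonal]; simp [← Real.exp_add]
  have h2 : Matrix.diagonal (fun i => Real.exp (t i)) * Matrix.diagonal (fun i => Real.exp (-(t i))) = 1 := by
    rw [Matrix.diagonal_mul_diagonal]; simp [← Real.exp_add]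
  rw [DC_eq, ← mul_assoc, ← mul_assoc, h1, one_mul, mul_assoc, h2, mul_one]

lemma DC_quad (C : Matrix V V ℝ) (hC : C.IsSymm) (η t v : V → ℝ) :
    v ⬝ᵥ (DC C η t).mulVec v = (1/2) * ∑ i, ∑ j, C i j * ((v i - v j) ^ 2 * Real.exp (t i + t j))
      + ∑ i, η i * (v i ^ 2 * Real.exp (t i)) := by
  have h1 : v ⬝ᵥ (DC C η t).mulVec v
      = ∑ i, ∑ j, C i j * (v i ^ 2 * Real.exp (t i + t j)) + ∑ i, η i * (v i ^ 2 * Real.exp (t i))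
        - ∑ i, ∑ j, C i j * (v i * v j * Real.exp (t i + t j)) := by
    rw [← Finset.sum_add_distrib, ← Finset.sum_sub_distrib]
    simp only [dotProduct, Matrix.mulVec, DC, Matrix.of_apply]
    refine Finset.sum_congr rfl fun i _ => ?_
    simp only [sub_mul, Finset.sum_sub_distrib, ite_mul, zero_mul, Finset.sum_ite_eq, Finset.mem_univ, if_true]
    rw [mul_sub]
    congr 1
    · have : ∑ j, C i j * (v i ^ 2 * Real.exp (t i + t j)) = v i ^ 2 * Real.exp (t i) * ∑ j, C i j * Real.exp (t j) := by
        rw [Finset.mul_sum]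
        refine Finset.sum_congr rfl fun j _ => ?_
        rw [Real.exp_add]; ring
      rw [this]; ring
    · rw [Finset.mul_sum]
      refine Finset.sum_congr rfl fun j _ => ?_
      rw [Real.exp_add]; ring
  have h2 : ∑ i, ∑ j, C i j * (v j ^ 2 * Real.exp (t i + t j)) = ∑ i, ∑ j, C i j * (v i ^ 2 * Real.exp (t i + t j)) := by
    rw [Finset.sum_comm]
    refine Finset.sum_congr rfl fun i _ => Finset.sum_congr rfl fun j _ => ?_
    rw [hC.apply, add_comm]
  have h3 : ∑ i, ∑ j, C i j * ((v i - v j) ^ 2 * Real.exp (t i + t j))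
      = ∑ i, ∑ j, C i j * (v i ^ 2 * Real.exp (t i + t j)) + ∑ i, ∑ j, C i j * (v j ^ 2 * Real.exp (t i + t j))
        - 2 * ∑ i, ∑ j, C i j * (v i * v j * Real.exp (t i + t j)) := by
    simp only [Finset.mul_sum, ← Finset.sum_add_distrib, ← Finset.sum_sub_distrib]
    refine Finset.sum_congr rfl fun i _ => Finset.sum_congr rfl fun j _ => ?_
    ring
  rw [h1, h3, h2]; ring

lemma DC_posDef (C : Matrix V V ℝ) (hC : C.IsSymm) (hC0 : ∀ i j, 0 ≤ C i j) (η t : V → ℝ)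
    (hη : ∀ i, 0 < η i) : (DC C η t).PosDef := by
  refine Matrix.PosDef.of_dotProduct_mulVec_pos ?_ ?_
  · rw [Matrix.IsHermitian, Matrix.conjTranspose_eq_transpose_of_trivial]
    ext i j
    simp only [Matrix.transpose_apply, DC, Matrix.of_apply]
    rw [hC.apply]
    by_cases h : i = j
    · subst h; rfl
    · rw [if_neg h, if_neg (Ne.symm h)]; ring
  · intro v hv
    rw [star_trivial, DC_quad C hC]
    obtain ⟨k, hk⟩ := Function.ne_iff.mp hv
    have hk' : v k ≠ 0 := hk
    have h1 : 0 ≤ ∑ i, ∑ j, C i j * ((v i - v j) ^ 2 * Real.exp (t i + t j)) :=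
      Finset.sum_nonneg fun i _ => Finset.sum_nonneg fun j _ => mul_nonneg (hC0 i j) (by positivity)
    have h2 : 0 < ∑ i, η i * (v i ^ 2 * Real.exp (t i)) := by
      refine Finset.sum_pos' (fun i _ => mul_nonneg (hη i).le (by positivity)) ⟨k, Finset.mem_univ _, ?_⟩
      exact mul_pos (hη k) (by positivity)
    linarith

lemma H_posDef (C : Matrix V V ℝ) (hC : C.IsSymm) (hC0 : ∀ i j, 0 ≤ C i j) (η t : V → ℝ)
    (hη : ∀ i, 0 < η i) : (Matrix.diagonal (fb C η t) - C).PosDef := by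
  rw [H_eq]
  have h := DC_posDef C hC hC0 η t hη
  have hinj : Function.Injective (Matrix.diagonal (fun i => Real.exp (-(t i)))).mulVec := by
    intro v w hvw
    ext i
    have := congrFun hvw i
    simpa [Matrix.mulVec_diagonal] using this
  have := h.conjTranspose_mul_mul_same hinj
  simpa [Matrix.diagonal_conjTranspose] using this

lemma DC_det (C : Matrix V V ℝ) (η t : V → ℝ) :
    (DC C η t).det = (∏ i, Real.exp (t i)) ^ 2 * (Matrix.diagonal (fb C η t) - C).det := by
  rw [DC_eq, Matrix.det_mul, Matrix.det_mul, Matrix.det_diagonal]; ring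

lemma H_solve (C : Matrix V V ℝ) (η t : V → ℝ) :
    (Matrix.diagonal (fb C η t) - C).mulVec (fun i => Real.exp (t i)) = η := by
  ext i
  rw [Matrix.sub_mulVec, Pi.sub_apply, Matrix.mulVec_diagonal, fb]
  have : Real.exp (-(t i)) * Real.exp (t i) = 1 := by rw [← Real.exp_add]; simp
  simp only [Matrix.mulVec, dotProduct]
  linear_combination (∑ k, C i k * Real.exp (t k) + η i) * this

lemma H_inv (C : Matrix V V ℝ) (hC : C.IsSymm) (hC0 : ∀ i j, 0 ≤ C i j) (η t : V → ℝ)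
    (hη : ∀ i, 0 < η i) : (Matrix.diagonal (fb C η t) - C)⁻¹.mulVec η = fun i => Real.exp (t i) := by
  have hu : IsUnit (Matrix.diagonal (fb C η t) - C).det := (H_posDef C hC hC0 η t hη).det_pos.ne'.isUnit
  conv_lhs => rw [← H_solve C η t]
  rw [H_solve, ← H_solve C η t, Matrix.mulVec_mulVec, H_solve, Matrix.nonsing_inv_mul _ hu, Matrix.one_mulVec]

lemma fb_inj (C : Matrix V V ℝ) (hC : C.IsSymm) (hC0 : ∀ i j, 0 ≤ C i j) (η : V → ℝ)
    (hη : ∀ i, 0 < η i) : Function.Injective (fb C η) := by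
  intro t t' h
  have h1 := H_inv C hC hC0 η t hη
  rw [h, H_inv C hC hC0 η t' hη] at h1
  ext i
  exact (Real.exp_injective (congrFun h1 i)).symm

lemma fb_deriv (C : Matrix V V ℝ) (η t : V → ℝ) :
    HasFDerivAt (fb C η) (LinearMap.toContinuousLinearMap (Matrix.toLin' (-(Matrix.diagonal (fun i => Real.exp (-(t i)))
      * (Matrix.diagonal (fb C η t) - C) * Matrix.diagonal (fun i => Real.exp (t i)))))) t := by
  rw [hasFDerivAt_pi']
  intro i
  have hp : ∀ j, HasFDerivAt (fun t : V → ℝ => t j) (ContinuousLinearMap.proj (R := ℝ) (φ := fun _ : V => ℝ) j) t :=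
    fun j => hasFDerivAt_apply j t
  have h1 : HasFDerivAt (fun t : V → ℝ => ∑ j, C i j * Real.exp (t j) + η i)
      (∑ j, C i j • Real.exp (t j) • ContinuousLinearMap.proj (R := ℝ) (φ := fun _ : V => ℝ) j) t := by
    refine HasFDerivAt.add_const _ ?_
    exact HasFDerivAt.fun_sum fun j _ => ((hp j).exp.const_mul (C i j))
  have h2 := h1.mul ((hp i).neg.exp)
  refine h2.congr_fderiv ?_
  ext v
  simp only [_root_.add_apply, _root_.smul_apply, _root_.neg_apply,
    _root_.sum_apply, ContinuousLinearMap.proj_apply, ContinuousLinearMap.comp_apply,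
    LinearMap.coe_toContinuousLinearMap', Matrix.toLin'_apply, smul_eq_mul]
  rw [Matrix.neg_mulVec, ← Matrix.mulVec_mulVec, ← Matrix.mulVec_mulVec, Pi.neg_apply, Pi.neg_apply, Matrix.mulVec_diagonal,
    Matrix.sub_mulVec, Pi.sub_apply, Matrix.mulVec_diagonal, Matrix.mulVec_diagonal]
  have hs : C.mulVec ((Matrix.diagonal fun i => Real.exp (t i)).mulVec v) i
     = ∑ j, C i j * (Real.exp (t j) * v j) := by
    simp only [Matrix.mulVec, dotProduct]
    simp [Matrix.diagonal_apply]
  rw [hs, fb]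
  have : Real.exp (-(t i)) * Real.exp (t i) = 1 := by rw [← Real.exp_add]; simp
  linear_combination (∑ k, C i k * Real.exp (t k) + η i) * Real.exp (-(t i)) * v i * this

lemma t_integral (C : Matrix V V ℝ) (hC : C.IsSymm) (hC0 : ∀ i j, 0 ≤ C i j) (η : V → ℝ)
    (hη : ∀ i, 0 < η i) :
    ∫⁻ t : V → ℝ, ENNReal.ofReal (Real.sqrt (Matrix.diagonal (fb C η t) - C).det *
      Real.exp (-((1/2) * ∑ i, ∑ j, C i j * Real.cosh (t i - t j)) - ∑ i, η i * Real.cosh (t i)))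
    ≤ ENNReal.ofReal (Real.sqrt (2 * Real.pi) ^ Fintype.card V *
      Real.exp (-(1/2) * ∑ i, ∑ j, C i j - ∑ i, η i)) := by
  refine le_trans ?_ (HP_all V C η hC)
  refine le_trans (le_of_eq ?_) (setLIntegral_le_lintegral (fb C η '' Set.univ) _)
  rw [lintegral_image_eq_lintegral_abs_det_fderiv_mul volume MeasurableSet.univ
    (fun t _ => (fb_deriv C η t).hasFDerivWithinAt) (fb_inj C hC hC0 η hη).injOn, setLIntegral_univ]
  refine lintegral_congr fun t => ?_
  have hP := H_posDef C hC hC0 η t hη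
  have hd := hP.det_pos
  rw [HPfun, if_pos hP, H_inv C hC hC0 η t hη, ← ENNReal.ofReal_mul (abs_nonneg _)]
  congr 1
  have hdet : |(LinearMap.toContinuousLinearMap (Matrix.toLin' (-(Matrix.diagonal (fun i => Real.exp (-(t i)))
      * (Matrix.diagonal (fb C η t) - C) * Matrix.diagonal (fun i => Real.exp (t i)))))).det|
      = (Matrix.diagonal (fb C η t) - C).det := by
    have h1 : (LinearMap.toContinuousLinearMap (Matrix.toLin' (-(Matrix.diagonal (fun i => Real.exp (-(t i)))
      * (Matrix.diagonal (fb C η t) - C) * Matrix.diagonal (fun i => Real.exp (t i)))))).det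
      = (-(Matrix.diagonal (fun i => Real.exp (-(t i)))
      * (Matrix.diagonal (fb C η t) - C) * Matrix.diagonal (fun i => Real.exp (t i)))).det := by
      rw [← LinearMap.det_toLin']; rfl
    rw [h1, Matrix.det_neg, Matrix.det_mul, Matrix.det_mul, Matrix.det_diagonal, Matrix.det_diagonal,
      abs_mul, abs_pow, abs_neg, abs_one, one_pow, one_mul, mul_right_comm, ← Finset.prod_mul_distrib]
    simp only [← Real.exp_add, neg_add_cancel, Real.exp_zero, Finset.prod_const_one, one_mul]
    exact abs_of_pos hd
  rw [hdet, ← mul_div_assoc, mul_div_right_comm, Real.div_sqrt]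
  congr 2
  have e1 : ∑ i, fb C η t i = ∑ i, ∑ j, C i j * Real.exp (t j - t i) + ∑ i, η i * Real.exp (-(t i)) := by
    rw [← Finset.sum_add_distrib]
    refine Finset.sum_congr rfl fun i _ => ?_
    rw [fb, add_mul, Finset.sum_mul]
    congr 1
    refine Finset.sum_congr rfl fun j _ => ?_
    rw [sub_eq_add_neg, Real.exp_add]; ring
  have e2 : ∑ i, ∑ j, C i j * Real.cosh (t i - t j) = ∑ i, ∑ j, C i j * Real.exp (t j - t i) := by
    have e3 : ∑ i, ∑ j, C i j * Real.exp (t i - t j) = ∑ i, ∑ j, C i j * Real.exp (t j - t i) := by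
      rw [Finset.sum_comm]
      refine Finset.sum_congr rfl fun i _ => Finset.sum_congr rfl fun j _ => ?_
      rw [hC.apply]
    have e4 : ∑ i, ∑ j, C i j * Real.cosh (t i - t j)
        = (1/2) * (∑ i, ∑ j, C i j * Real.exp (t i - t j) + ∑ i, ∑ j, C i j * Real.exp (t j - t i)) := by
      simp only [Finset.mul_sum, ← Finset.sum_add_distrib]
      refine Finset.sum_congr rfl fun i _ => Finset.sum_congr rfl fun j _ => ?_
      rw [Real.cosh_eq, neg_sub]; ring
    rw [e4, e3]; ring
  have e5 : ∑ i, η i * Real.cosh (t i) = (1/2) * (∑ i, η i * Real.exp (-(t i)) + ∑ i, η i * Real.exp (t i)) := by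
    simp only [Finset.mul_sum, ← Finset.sum_add_distrib]
    refine Finset.sum_congr rfl fun i _ => ?_
    rw [Real.cosh_eq]; ring
  rw [e1, e2, e5]
  simp only [dotProduct]
  ring

/-- Generic integrand of the linear model with edge weights `C` and pinning `η`. -/
def gT (C : Matrix V V ℝ) (η t s : V → ℝ) : ℝ :=
  (DC C η t).det *
    Real.exp (-((1/2) * ∑ i, ∑ j, C i j * (Real.cosh (t i - t j) + (1/2) * (s i - s j) ^ 2 * Real.exp (t i + t j) - 1))
      - ∑ k, η k * (Real.cosh (t k) + (1/2) * (s k) ^ 2 * Real.exp (t k) - 1)) *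
    (∏ k, Real.exp (-(t k))) * ((2 * Real.pi)⁻¹) ^ (Fintype.card V)

lemma gT_split (C : Matrix V V ℝ) (hC : C.IsSymm) (η t s : V → ℝ) :
    gT C η t s = ((DC C η t).det * (∏ k, Real.exp (-(t k))) * ((2 * Real.pi)⁻¹) ^ (Fintype.card V) *
      Real.exp ((1/2) * ∑ i, ∑ j, C i j + ∑ i, η i) *
      Real.exp (-((1/2) * ∑ i, ∑ j, C i j * Real.cosh (t i - t j)) - ∑ i, η i * Real.cosh (t i))) *
      Real.exp (-(1/2) * (s ⬝ᵥ (DC C η t).mulVec s)) := by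
  rw [DC_quad C hC]
  have e1 : ∑ i, ∑ j, C i j * (Real.cosh (t i - t j) + (1/2) * (s i - s j) ^ 2 * Real.exp (t i + t j) - 1)
      = ∑ i, ∑ j, C i j * Real.cosh (t i - t j) + (1/2) * ∑ i, ∑ j, C i j * ((s i - s j) ^ 2 * Real.exp (t i + t j))
        - ∑ i, ∑ j, C i j := by
    simp only [Finset.mul_sum, ← Finset.sum_add_distrib, ← Finset.sum_sub_distrib]
    refine Finset.sum_congr rfl fun i _ => Finset.sum_congr rfl fun j _ => ?_
    ring
  have e2 : ∑ k, η k * (Real.cosh (t k) + (1/2) * (s k) ^ 2 * Real.exp (t k) - 1)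
      = ∑ k, η k * Real.cosh (t k) + (1/2) * ∑ k, η k * (s k ^ 2 * Real.exp (t k)) - ∑ k, η k := by
    simp only [Finset.mul_sum, ← Finset.sum_add_distrib, ← Finset.sum_sub_distrib]
    refine Finset.sum_congr rfl fun i _ => ?_
    ring
  rw [gT, e1, e2]
  rw [mul_assoc (_ * _) (Real.exp _) (Real.exp _), ← Real.exp_add, mul_assoc (_ * _) (Real.exp _) (Real.exp _), ← Real.exp_add]
  have : ∀ a b c d x y : ℝ, x = y → a * Real.exp x * c * d = a * c * d * Real.exp y := by
    intro a b c d x y h; rw [h]; ring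
  refine this _ 0 _ _ _ _ ?_
  ring

lemma gT_lintegral (C : Matrix V V ℝ) (hC : C.IsSymm) (hC0 : ∀ i j, 0 ≤ C i j) (η : V → ℝ)
    (hη : ∀ i, 0 < η i) :
    ∫⁻ p : (V → ℝ) × (V → ℝ), ENNReal.ofReal (gT C η p.1 p.2) ≤ 1 := by
  refine (lintegral_prod_le _).trans ?_
  have hs : ∀ t : V → ℝ, ∫⁻ s : V → ℝ, ENNReal.ofReal (gT C η t s)
      = ENNReal.ofReal ((Real.sqrt (2 * Real.pi))⁻¹ ^ (Fintype.card V) *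
          Real.exp ((1/2) * ∑ i, ∑ j, C i j + ∑ i, η i)) *
        ENNReal.ofReal (Real.sqrt (Matrix.diagonal (fb C η t) - C).det *
      Real.exp (-((1/2) * ∑ i, ∑ j, C i j * Real.cosh (t i - t j)) - ∑ i, η i * Real.cosh (t i))) := by
    intro t
    have hD := DC_posDef C hC hC0 η t hη
    have hDd := hD.det_pos
    simp_rw [gT_split C hC η]
    have hnn : 0 ≤ (DC C η t).det * (∏ k, Real.exp (-(t k))) * ((2 * Real.pi)⁻¹) ^ (Fintype.card V) *
      Real.exp ((1/2) * ∑ i, ∑ j, C i j + ∑ i, η i) *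
      Real.exp (-((1/2) * ∑ i, ∑ j, C i j * Real.cosh (t i - t j)) - ∑ i, η i * Real.cosh (t i)) := by
      have : 0 ≤ ∏ k, Real.exp (-(t k)) := Finset.prod_nonneg fun _ _ => (Real.exp_pos _).le
      positivity
    simp_rw [ENNReal.ofReal_mul hnn]
    rw [lintegral_const_mul' _ _ ENNReal.ofReal_ne_top, aux_gauss_matrix _ hD, ← ENNReal.ofReal_mul hnn,
      ← ENNReal.ofReal_mul (by positivity)]
    congr 1
    have hP := (H_posDef C hC hC0 η t hη).det_pos
    have hprod : 0 < ∏ i, Real.exp (t i) := Finset.prod_pos fun _ _ => Real.exp_pos _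
    have hprod' : ∏ k, Real.exp (-(t k)) = (∏ i, Real.exp (t i))⁻¹ := by
      rw [← Finset.prod_inv_distrib]
      exact Finset.prod_congr rfl fun i _ => Real.exp_neg _
    have h2 : ((2 * Real.pi)⁻¹) ^ (Fintype.card V) = ((Real.sqrt (2 * Real.pi))⁻¹ ^ (Fintype.card V)) ^ 2 := by
      rw [pow_right_comm, inv_pow (Real.sqrt _) 2, Real.sq_sqrt (by positivity)]
    rw [h2, hprod', DC_det, Real.sqrt_mul (sq_nonneg (∏ i, Real.exp (t i))), Real.sqrt_sq hprod.le]
    have h3 := Real.mul_self_sqrt hP.le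
    set r := Real.sqrt (Matrix.diagonal (fb C η t) - C).det with hr
    have hr0 : 0 < r := Real.sqrt_pos.mpr hP
    rw [← h3]
    have hpi : 0 < Real.sqrt (2 * Real.pi) := by positivity
    rw [inv_pow]
    generalize Real.exp ((1/2) * ∑ i, ∑ j, C i j + ∑ i, η i) = E1
    generalize Real.exp (-((1/2) * ∑ i, ∑ j, C i j * Real.cosh (t i - t j)) - ∑ i, η i * Real.cosh (t i)) = E2
    have hq : 0 < Real.sqrt (2 * Real.pi) ^ Fintype.card V := by positivity
    generalize Real.sqrt (2 * Real.pi) ^ Fintype.card V = Q at hq ⊢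
    generalize ∏ i, Real.exp (t i) = P at hprod ⊢
    clear_value r
    field_simp
  rw [lintegral_congr hs, lintegral_const_mul' _ _ ENNReal.ofReal_ne_top]
  refine (mul_le_mul_right (t_integral C hC hC0 η hη) _).trans (le_of_eq ?_)
  rw [← ENNReal.ofReal_mul (by positivity), ← ENNReal.ofReal_one]
  congr 1
  rw [mul_mul_mul_comm, ← mul_pow, inv_mul_cancel₀ (by positivity), one_pow, one_mul, ← Real.exp_add, Real.exp_eq_one_iff]
  ring

/-- symmetric edge indicator. -/
def eE (x y : V) : Matrix V V ℝ :=
  Matrix.of fun i j => (if i = x then 1 else 0) * (if j = y then 1 else 0)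
    + (if i = y then 1 else 0) * (if j = x then 1 else 0)

lemma eE_sum (x y : V) (F : V → V → ℝ) (hF : ∀ i j, F i j = F j i) :
    (1/2) * ∑ i, ∑ j, eE x y i j * F i j = F x y := by
  have : ∑ i, ∑ j, eE x y i j * F i j = F x y + F y x := by
    simp only [eE, Matrix.of_apply, add_mul, Finset.sum_add_distrib, ite_mul, one_mul, zero_mul]
    simp
  rw [this, hF y x]; ring

lemma DC_add (C : Matrix V V ℝ) (η t : V → ℝ) (c : ℝ) (x y : V) (hxy : x ≠ y) :
    DC (C + c • eE x y) η t = DC C η t + Matrix.replicateCol Unit ((c * Real.exp (t x + t y)) • (fun i => (if i = x then 1 else 0) - (if i = y then 1 else 0) : V → ℝ))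
      * Matrix.replicateRow Unit (fun i => (if i = x then 1 else 0) - (if i = y then 1 else 0) : V → ℝ) := by
  ext i j
  have hs : ∑ k, (C i k + c * eE x y i k) * Real.exp (t k) = ∑ k, C i k * Real.exp (t k)
     + c * ((if i = x then 1 else 0) * Real.exp (t y) + (if i = y then 1 else 0) * Real.exp (t x)) := by
    simp only [add_mul, Finset.sum_add_distrib]
    congr 1
    simp only [mul_assoc, ← Finset.mul_sum]
    congr 1
    simp [eE, add_mul, Finset.sum_add_distrib]
  simp only [DC, Matrix.of_apply, Matrix.add_apply, Matrix.smul_apply, smul_eq_mul, hs, Matrix.mul_apply,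
    Matrix.replicateCol_apply, Matrix.replicateRow_apply, Finset.univ_unique, Finset.sum_singleton, Pi.smul_apply]
  simp only [eE, Matrix.of_apply, Real.exp_add]
  have hyx := hxy.symm
  by_cases h1 : i = x
  · subst h1
    by_cases h2 : j = i
    · subst h2; simp [hxy]; ring
    · by_cases h3 : j = y
      · subst h3; simp [hxy, hyx]; ring
      · simp [hxy, hyx, h2, h3, Ne.symm h2]
  · by_cases h2 : i = y
    · subst h2
      by_cases h3 : j = i
      · subst h3; simp [h1]; ring
      · by_cases h4 : j = x
        · subst h4; simp [hxy, hyx]; ring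
        · simp [hyx, h3, h4, Ne.symm h3]
    · simp [h1, h2]

lemma DC_det_le (C : Matrix V V ℝ) (hC : C.IsSymm) (hC0 : ∀ i j, 0 ≤ C i j) (η t : V → ℝ)
    (hη : ∀ i, 0 < η i) (c l : ℝ) (hl1 : l ≤ 1) (x y : V) (hxy : x ≠ y) :
    l * (DC (C + c • eE x y) η t).det ≤ (DC (C + (l * c) • eE x y) η t).det := by
  have hP := (DC_posDef C hC hC0 η t hη).det_pos
  have hu : IsUnit (DC C η t).det := hP.ne'.isUnit
  rw [DC_add _ _ _ _ _ _ hxy, DC_add _ _ _ _ _ _ hxy, Matrix.det_add_replicateCol_mul_replicateRow hu,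
    Matrix.det_add_replicateCol_mul_replicateRow hu]
  have hq : ∃ q : ℝ, ∀ a : ℝ, (1 + Matrix.replicateRow Unit (fun i => (if i = x then 1 else 0) - (if i = y then 1 else 0) : V → ℝ)
      * (DC C η t)⁻¹ * Matrix.replicateCol Unit (a • (fun i => (if i = x then 1 else 0) - (if i = y then 1 else 0) : V → ℝ))).det = 1 + a * q := by
    refine ⟨(Matrix.replicateRow Unit (fun i => (if i = x then 1 else 0) - (if i = y then 1 else 0) : V → ℝ)
      * (DC C η t)⁻¹ * Matrix.replicateCol Unit (fun i => (if i = x then 1 else 0) - (if i = y then 1 else 0) : V → ℝ)) default default, fun a => ?_⟩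
    rw [Matrix.det_unique, Matrix.replicateCol_smul, Matrix.mul_smul]
    simp
  obtain ⟨q, hq⟩ := hq
  rw [hq, hq]
  nlinarith [mul_nonneg hP.le (sub_nonneg.mpr hl1)]

end generic

/-! ### The torus model -/

lemma NN_symm' {L : ℕ} {i j : Torus L} (h : NN i j) : NN j i := by
  obtain ⟨h1, k, h2⟩ := h
  refine ⟨h1.symm, k, ?_⟩
  rcases h2 with h2 | h2
  · right; rw [h2]; simp
  · left; rw [h2]; simp

/-- The adjacency matrix. -/
def NNmat (L : ℕ) : Matrix (Torus L) (Torus L) ℝ := Matrix.of fun i j => if NN i j then 1 else 0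

/-- Reduced edge weights. -/
def CS {L : ℕ} [NeZero L] (β m : ℝ) {n : ℕ} (x y : Fin n → Torus L) (S : Finset (Fin n)) :
    Matrix (Torus L) (Torus L) ℝ :=
  β • NNmat L - m • ∑ k ∈ S, eE (x k) (y k)

lemma Dmat_eq {L : ℕ} [NeZero L] (β ε : ℝ) (t : Torus L → ℝ) :
    Dmat β ε t = DC (β • NNmat L) (fun _ => ε) t := by
  ext i j
  simp only [Dmat, DC, Matrix.of_apply, Matrix.smul_apply, NNmat, smul_eq_mul]
  by_cases h : i = j
  · subst h
    have hn : ¬ NN i i := fun h => h.1 rfl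
    simp only [if_true, hn, if_false]
    rw [mul_add, Finset.mul_sum, Finset.mul_sum]
    have : ∀ k, β * (if NN k i then Real.exp (t k + t i) else 0)
        = Real.exp (t i) * (β * (if NN i k then 1 else 0) * Real.exp (t k)) := by
      intro k
      by_cases hk : NN i k
      · rw [if_pos hk, if_pos (NN_symm' hk), Real.exp_add]; ring
      · rw [if_neg hk, if_neg (fun h => hk (NN_symm' h))]; ring
    simp only [this]
    ring
  · simp only [h, if_false]
    split_ifs
    · rw [Real.exp_add]; ring
    · ring

lemma eE_apply' {V : Type*} [DecidableEq V] (x y : V) (hxy : x ≠ y) (i j : V) :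
    eE x y i j = if s(i, j) = s(x, y) then 1 else 0 := by
  simp only [eE, Matrix.of_apply, Sym2.eq_iff]
  by_cases h1 : i = x
  · subst h1; simp [hxy]
  · by_cases h2 : i = y
    · subst h2; simp [hxy.symm]
    · simp [h1, h2]

lemma eE_sum_le {L n : ℕ} (x y : Fin n → Torus L) (hNN : ∀ j, NN (x j) (y j))
    (hd : Function.Injective fun j => s(x j, y j)) (S : Finset (Fin n)) (i j : Torus L) :
    (∑ k ∈ S, eE (x k) (y k) i j) ≤ NNmat L i j := by
  have h1 : ∀ k, eE (x k) (y k) i j = if s(i, j) = s(x k, y k) then 1 else 0 :=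
    fun k => eE_apply' _ _ (hNN k).1 i j
  simp only [h1, NNmat, Matrix.of_apply]
  split_ifs with h
  · rw [Finset.sum_boole]
    have : (Finset.filter (fun k => s(i, j) = s(x k, y k)) S).card ≤ 1 := by
      rw [Finset.card_le_one]
      intro a ha b hb
      rw [Finset.mem_filter] at ha hb
      exact hd (ha.2.symm.trans hb.2)
    exact_mod_cast this
  · refine le_of_eq (Finset.sum_eq_zero fun k _ => if_neg ?_)
    intro hk
    rcases Sym2.eq_iff.mp hk with ⟨rfl, rfl⟩ | ⟨rfl, rfl⟩
    · exact h (hNN k)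
    · exact h (NN_symm' (hNN k))

lemma eE_nonneg {V : Type*} [DecidableEq V] (x y i j : V) : 0 ≤ eE x y i j := by
  simp only [eE, Matrix.of_apply]
  positivity

lemma eE_symm {V : Type*} [DecidableEq V] (x y : V) : (eE x y).IsSymm := by
  ext i j
  simp only [eE, Matrix.of_apply, Matrix.transpose_apply]; ring

lemma CS_symm {L n : ℕ} [NeZero L] (β m : ℝ) (x y : Fin n → Torus L) (S : Finset (Fin n)) :
    (CS β m x y S).IsSymm := by
  ext i j
  simp only [CS, Matrix.transpose_apply, Matrix.sub_apply, Matrix.smul_apply, Matrix.sum_apply, NNmat,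
    Matrix.of_apply]
  have h1 : NN j i ↔ NN i j := ⟨NN_symm', NN_symm'⟩
  simp only [h1, (eE_symm _ _).apply i j]

lemma CS_nonneg {L n : ℕ} [NeZero L] (β m : ℝ) (hm0 : 0 ≤ m) (hm : m ≤ β) (x y : Fin n → Torus L)
    (hNN : ∀ j, NN (x j) (y j)) (hd : Function.Injective fun j => s(x j, y j)) (S : Finset (Fin n))
    (i j : Torus L) : 0 ≤ CS β m x y S i j := by
  simp only [CS, Matrix.sub_apply, Matrix.smul_apply, Matrix.sum_apply, smul_eq_mul]
  have h1 := eE_sum_le x y hNN hd S i j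
  have h2 : 0 ≤ ∑ k ∈ S, eE (x k) (y k) i j := Finset.sum_nonneg fun k _ => eE_nonneg _ _ _ _
  nlinarith

lemma CS_nonneg' {L n : ℕ} [NeZero L] (β m : ℝ) (hm0 : 0 ≤ m) (hm : m ≤ β) (x y : Fin n → Torus L)
    (hNN : ∀ j, NN (x j) (y j)) (hd : Function.Injective fun j => s(x j, y j)) (S : Finset (Fin n))
    (k : Fin n) (hk : k ∉ S)
    (i j : Torus L) : 0 ≤ (CS β m x y S - β • eE (x k) (y k)) i j := by
  simp only [CS, Matrix.sub_apply, Matrix.smul_apply, Matrix.sum_apply, smul_eq_mul]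
  have h1 := eE_sum_le x y hNN hd (insert k S) i j
  rw [Finset.sum_insert hk] at h1
  have h2 : 0 ≤ ∑ k ∈ S, eE (x k) (y k) i j := Finset.sum_nonneg fun k _ => eE_nonneg _ _ _ _
  have h3 := eE_nonneg (x k) (y k) i j
  nlinarith

lemma CS_det {L n : ℕ} [NeZero L] (β ε m : ℝ) (hβ : 0 < β) (hε : 0 < ε) (hm0 : 0 ≤ m) (hm : m ≤ β)
    (x y : Fin n → Torus L)
    (hNN : ∀ j, NN (x j) (y j)) (hd : Function.Injective fun j => s(x j, y j)) (S : Finset (Fin n))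
    (t : Torus L → ℝ) :
    (1 - m / β) ^ S.card * (Dmat β ε t).det ≤ (DC (CS β m x y S) (fun _ => ε) t).det := by
  have hl0 : 0 ≤ 1 - m / β := sub_nonneg.mpr ((div_le_one hβ).mpr hm)
  have hl1 : 1 - m / β ≤ 1 := sub_le_self _ (by positivity)
  induction S using Finset.induction_on with
  | empty => simp [CS, Dmat_eq]
  | insert k S hk ih =>
    rw [Finset.card_insert_of_notMem hk, pow_succ', mul_assoc]
    refine (mul_le_mul_of_nonneg_left ih hl0).trans ?_
    have hs : (CS β m x y S - β • eE (x k) (y k)).IsSymm :=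
      (CS_symm β m x y S).sub ((eE_symm _ _).smul β)
    have h := DC_det_le (CS β m x y S - β • eE (x k) (y k)) hs
      (CS_nonneg' β m hm0 hm x y hNN hd S k hk) (fun _ => ε) t (fun _ => hε) β (1 - m / β) hl1
      (x k) (y k) (hNN k).1
    have e1 : CS β m x y S - β • eE (x k) (y k) + β • eE (x k) (y k) = CS β m x y S := by abel
    have e2 : CS β m x y S - β • eE (x k) (y k) + ((1 - m / β) * β) • eE (x k) (y k)
        = CS β m x y (insert k S) := by
      have : (1 - m / β) * β = β - m := by field_simp
      rw [this, sub_smul, CS, CS, Finset.sum_insert hk, smul_add]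
      abel
    rwa [e1, e2] at h

lemma CS_energy {L n : ℕ} [NeZero L] (β m : ℝ) (x y : Fin n → Torus L) (F : Torus L → Torus L → ℝ)
    (hF : ∀ i j, F i j = F j i) (S : Finset (Fin n)) :
    (1/2) * ∑ i, ∑ j, CS β m x y S i j * F i j = β * nnSum F - m * ∑ k ∈ S, F (x k) (y k) := by
  have h1 : ∀ k, F (x k) (y k) = (1/2) * ∑ i, ∑ j, eE (x k) (y k) i j * F i j :=
    fun k => (eE_sum _ _ F hF).symm
  have h2 : ∑ k ∈ S, F (x k) (y k) = (1/2) * ∑ i, ∑ j, (∑ k ∈ S, eE (x k) (y k) i j) * F i j := by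
    simp only [h1, ← Finset.mul_sum]
    rw [Finset.sum_comm]
    congr 1
    refine Finset.sum_congr rfl fun i _ => ?_
    rw [Finset.sum_comm]
    refine Finset.sum_congr rfl fun j _ => ?_
    rw [Finset.sum_mul]
  rw [h2, nnSum]
  simp only [CS, Matrix.sub_apply, Matrix.smul_apply, Matrix.sum_apply, smul_eq_mul, sub_mul,
    Finset.sum_sub_distrib, NNmat, Matrix.of_apply, mul_assoc, ← Finset.mul_sum, ite_mul, one_mul, zero_mul]
  ring

lemma gT_continuous {V : Type*} [Fintype V] [DecidableEq V] (C : Matrix V V ℝ) (η : V → ℝ) :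
    Continuous fun p : (V → ℝ) × (V → ℝ) => gT C η p.1 p.2 := by
  have h1 : Continuous fun p : (V → ℝ) × (V → ℝ) => (DC C η p.1).det := by
    refine Continuous.matrix_det ?_
    refine continuous_matrix fun i j => ?_
    simp only [DC, Matrix.of_apply]
    split_ifs <;> fun_prop
  unfold gT
  fun_prop

/-- **Moment bound for nearest-neighbor pairs.** For `0 ≤ m ≤ β/2` and `n` pairwise
distinct nearest-neighbor pairs, `⟨∏ B_{x_j y_j}^m⟩ ≤ (1 - m/β)⁻ⁿ ≤ 2ⁿ`. -/
theorem nn_moment_bound (β ε : ℝ) (hβ : 0 < β) (hε : 0 < ε) (L : ℕ)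
    (m : ℝ) (hm0 : 0 ≤ m) (hm : m ≤ β / 2)
    (n : ℕ) (x y : Fin n → Torus (L + 2)) (hNN : ∀ j, NN (x j) (y j))
    (hdistinct : Function.Injective fun j => s(x j, y j)) :
    tsExpect β ε (fun t s => ∏ j, Bq t s (x j) (y j) ^ m) ≤ ((1 - m / β)⁻¹) ^ n ∧
      ((1 - m / β)⁻¹) ^ n ≤ 2 ^ n := by
  have hm' : m ≤ β := by linarith
  have hmb : m / β ≤ 1 / 2 := by rw [div_le_iff₀ hβ]; linarith
  have hl : 0 < 1 - m / β := by linarith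
  refine ⟨?_, ?_⟩
  swap
  · refine pow_le_pow_left₀ (inv_nonneg.mpr hl.le) ?_ n
    rw [inv_le_comm₀ hl (by norm_num)]
    linarith
  set C := CS β m x y Finset.univ with hC
  have hsymm := CS_symm β m x y Finset.univ
  have hnn := CS_nonneg β m hm0 hm' x y hNN hdistinct Finset.univ
  have hlint := gT_lintegral C hsymm hnn (fun _ => ε) (fun _ => hε)
  have hgnn : ∀ p : (Torus (L + 2) → ℝ) × (Torus (L + 2) → ℝ), 0 ≤ gT C (fun _ => ε) p.1 p.2 := by
    intro p
    have h1 := (DC_posDef C hsymm hnn (fun _ => ε) p.1 (fun _ => hε)).det_pos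
    have : 0 ≤ ∏ k, Real.exp (-(p.1 k)) := Finset.prod_nonneg fun _ _ => (Real.exp_pos _).le
    unfold gT
    positivity
  have hmeas := (gT_continuous C (fun _ => ε)).aestronglyMeasurable (μ := volume)
  have hgInt : Integrable (fun p : (Torus (L + 2) → ℝ) × (Torus (L + 2) → ℝ) => gT C (fun _ => ε) p.1 p.2) := by
    refine ⟨hmeas, ?_⟩
    rw [hasFiniteIntegral_iff_ofReal (Filter.Eventually.of_forall hgnn)]
    exact hlint.trans_lt ENNReal.one_lt_top
  have hle1 : ∫ p : (Torus (L + 2) → ℝ) × (Torus (L + 2) → ℝ), gT C (fun _ => ε) p.1 p.2 ≤ 1 := by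
    rw [integral_eq_lintegral_of_nonneg_ae (Filter.Eventually.of_forall hgnn) hmeas]
    exact ENNReal.toReal_le_of_le_ofReal zero_le_one (by simpa using hlint)
  have hBge : ∀ (t s : Torus (L + 2) → ℝ) i j, 1 ≤ Bq t s i j := by
    intro t s i j
    have := Real.one_le_cosh (t i - t j)
    have h2 : 0 ≤ (1 / 2) * (s i - s j) ^ 2 * Real.exp (t i + t j) := by positivity
    unfold Bq; linarith
  have hBsymm : ∀ (t s : Torus (L + 2) → ℝ) i j, Bq t s i j - 1 = Bq t s j i - 1 := by
    intro t s i j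
    unfold Bq
    rw [← Real.cosh_neg, neg_sub, add_comm (t i)]; ring
  have hDpos : ∀ t : Torus (L + 2) → ℝ, 0 ≤ (Dmat β ε t).det := by
    intro t
    have h0 := CS_symm β m x y ∅
    have h1 := CS_nonneg β m hm0 hm' x y hNN hdistinct ∅
    have h2 : CS β m x y ∅ = β • NNmat (L + 2) := by simp [CS]
    rw [h2] at h0 h1
    rw [Dmat_eq]
    exact (DC_posDef _ h0 h1 (fun _ => ε) t (fun _ => hε)).det_pos.le
  have hprodnn : ∀ t : Torus (L + 2) → ℝ, 0 ≤ ∏ k, Real.exp (-(t k)) :=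
    fun t => Finset.prod_nonneg fun _ _ => (Real.exp_pos _).le
  have hBpos : ∀ t s : Torus (L + 2) → ℝ, 0 ≤ ∏ j, Bq t s (x j) (y j) ^ m := fun t s =>
    Finset.prod_nonneg fun j _ => Real.rpow_nonneg (zero_le_one.trans (hBge t s _ _)) _
  calc tsExpect β ε (fun t s => ∏ j, Bq t s (x j) (y j) ^ m)
      ≤ ∫ p : (Torus (L + 2) → ℝ) × (Torus (L + 2) → ℝ),
          ((1 - m / β)⁻¹) ^ n * gT C (fun _ => ε) p.1 p.2 := by
        unfold tsExpect
        refine integral_mono_of_nonneg (Filter.Eventually.of_forall fun p => ?_) (hgInt.const_mul _)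
          (Filter.Eventually.of_forall fun p => ?_)
        · have h1 := hBpos p.1 p.2
          have h2 := hDpos p.1
          have h3 := hprodnn p.1
          simp only [Pi.zero_apply]
          positivity
        · obtain ⟨t, s⟩ := p
          have hd := CS_det β ε m hβ hε hm0 hm' x y hNN hdistinct Finset.univ t
          rw [Finset.card_univ, Fintype.card_fin, ← hC] at hd
          have hd' : (Dmat β ε t).det ≤ ((1 - m / β)⁻¹) ^ n * (DC C (fun _ => ε) t).det := by
            rw [inv_pow, ← div_eq_inv_mul, le_div_iff₀ (by positivity), mul_comm]
            exact hd
          have hB : (∏ j, Bq t s (x j) (y j) ^ m) ≤ Real.exp (m * ∑ j, (Bq t s (x j) (y j) - 1)) := by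
            rw [Finset.mul_sum, Real.exp_sum]
            refine Finset.prod_le_prod (fun j _ => Real.rpow_nonneg (zero_le_one.trans (hBge t s _ _)) _)
              fun j _ => ?_
            have hb := hBge t s (x j) (y j)
            have hb0 : 0 < Bq t s (x j) (y j) := by linarith
            rw [Real.rpow_def_of_pos hb0, mul_comm]
            exact Real.exp_le_exp.mpr (mul_le_mul_of_nonneg_left (Real.log_le_sub_one_of_pos hb0) hm0)
          have hen := CS_energy β m x y (fun i j => Bq t s i j - 1) (hBsymm t s) Finset.univ
          rw [← hC] at hen
          have hgT : gT C (fun _ => ε) t s = (DC C (fun _ => ε) t).det *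
              Real.exp (-(β * nnSum (fun i j => Bq t s i j - 1) - m * ∑ j, (Bq t s (x j) (y j) - 1))
                - ε * ∑ k, (zb t s k - 1)) *
              (∏ k, Real.exp (-(t k))) * ((2 * Real.pi)⁻¹) ^ (Fintype.card (Torus (L + 2))) := by
            have hz : ε * ∑ k, (zb t s k - 1) = ∑ k, ε * (zb t s k - 1) := Finset.mul_sum _ _ _
            rw [← hen, hz]
            rfl
          have hexp : Real.exp (-(β * nnSum (fun i j => Bq t s i j - 1) - m * ∑ j, (Bq t s (x j) (y j) - 1))
                - ε * ∑ k, (zb t s k - 1)) = Real.exp (m * ∑ j, (Bq t s (x j) (y j) - 1)) *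
                Real.exp (-(β * nnSum (fun i j => Bq t s i j - 1)) - ε * ∑ k, (zb t s k - 1)) := by
            rw [← Real.exp_add]; congr 1; ring
          simp only
          rw [hgT, hexp, ← mul_assoc, ← mul_assoc, ← mul_assoc]
          refine mul_le_mul_of_nonneg_right (mul_le_mul_of_nonneg_right ?_ (hprodnn t)) (by positivity)
          rw [← mul_assoc]
          refine mul_le_mul_of_nonneg_right ?_ (Real.exp_pos _).le
          rw [mul_comm]
          exact mul_le_mul hd' hB (hBpos t s) (le_trans (hDpos t) hd')
    _ = ((1 - m / β)⁻¹) ^ n * ∫ p : (Torus (L + 2) → ℝ) × (Torus (L + 2) → ℝ), gT C (fun _ => ε) p.1 p.2 :=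
        integral_const_mul _ _
    _ ≤ ((1 - m / β)⁻¹) ^ n * 1 := by
        refine mul_le_mul_of_nonneg_left hle1 (by positivity)
    _ = _ := mul_one _

end
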